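/- arXiv:dg-ga/9503006 — 2 statements merged into one kernel-verified Lean document; each statement's English description precedes it below -/
import Mathlib

section
/- The function g : ℝ → ℝ defined by g(x) = exp(-x³)·∫₀ˣ exp(2u³) du satisfies -g''(x) + (9x⁴ - 6x)·g(x) = 0 for all x ∈ ℝ, and moreover g(0) = 0 and g'(0) = 1. -/
/-- First derivative of `g`. -/
theorem g_hasDerivAt (x : ℝ) :
    HasDerivAt (fun y : ℝ => Real.exp (-y ^ 3) * ∫ u in (0:ℝ)..y, Real.exp (2 * u ^ 3))
      (-3 * x ^ 2 * (Real.exp (-x ^ 3) * ∫ u in (0:ℝ)..x, Real.exp (2 * u ^ 3))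
        + Real.exp (x ^ 3)) x := by
  have hc : Continuous (fun u : ℝ => Real.exp (2 * u ^ 3)) := by fun_prop
  have h1 : HasDerivAt (fun y : ℝ => ∫ u in (0:ℝ)..y, Real.exp (2 * u ^ 3))
      (Real.exp (2 * x ^ 3)) x := hc.integral_hasStrictDerivAt 0 x |>.hasDerivAt
  have h2 : HasDerivAt (fun y : ℝ => Real.exp (-y ^ 3)) (Real.exp (-x ^ 3) * (-(3 * x ^ 2))) x := by
    have := (hasDerivAt_pow 3 x).fun_neg.exp
    simpa using this
  have h3 := h2.fun_mul h1
  have he : Real.exp (-x ^ 3) * Real.exp (2 * x ^ 3) = Real.exp (x ^ 3) := by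
    rw [← Real.exp_add]; congr 1; ring
  rw [he] at h3
  exact h3.congr_deriv (by ring)

/-- The function `g x = exp (-x³) ∫₀ˣ exp (2u³) du` satisfies `P(1) g = 0`,
`g 0 = 0` and `g' 0 = 1`. -/
theorem stmt3 :
    (∀ x : ℝ,
        -(deriv (deriv (fun y : ℝ => Real.exp (-y ^ 3) * ∫ u in (0:ℝ)..y, Real.exp (2 * u ^ 3)))) x
          + (9 * x ^ 4 - 6 * x) * (Real.exp (-x ^ 3) * ∫ u in (0:ℝ)..x, Real.exp (2 * u ^ 3)) = 0) ∧
      (Real.exp (-(0:ℝ) ^ 3) * ∫ u in (0:ℝ)..(0:ℝ), Real.exp (2 * u ^ 3)) = 0 ∧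
      deriv (fun y : ℝ => Real.exp (-y ^ 3) * ∫ u in (0:ℝ)..y, Real.exp (2 * u ^ 3)) 0 = 1 := by
  refine ⟨fun x => ?_, by simp, ?_⟩
  · have hd := funext fun x => (g_hasDerivAt x).deriv
    rw [hd]
    have h2 : HasDerivAt (fun y : ℝ => -3 * y ^ 2) (-3 * (2 * x)) x := by
      simpa using (hasDerivAt_pow 2 x).const_mul (-3 : ℝ)
    have h4 : HasDerivAt (fun y : ℝ => Real.exp (y ^ 3)) (Real.exp (x ^ 3) * (3 * x ^ 2)) x := by
      simpa using (hasDerivAt_pow 3 x).exp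
    rw [((h2.fun_mul (g_hasDerivAt x)).fun_add h4).deriv]
    ring
  · rw [(g_hasDerivAt 0).deriv]
    simp
end

section
/- Let f : ℝ → ℝ be twice differentiable with -f''(x) + (9x⁴ - 6x)·f(x) = 0 for all x ∈ ℝ. Then f(x) = f(0)·exp(-x³) + f'(0)·exp(-x³)·∫₀ˣ exp(2u³) du for all x ∈ ℝ. In other words, every solution of the equation P(1)f = 0 is of the form f = c₁·e^{-x³} + c₂·e^{-x³}∫₀ˣ e^{2u³} du with c₁, c₂ ∈ ℝ. -/
/-- Every twice differentiable solution of `P(1) f = 0`, i.e. of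
`-f'' + (9x⁴ - 6x) f = 0`, has the form
`f x = c₁ e^{-x³} + c₂ e^{-x³} ∫₀ˣ e^{2u³} du` with `c₁ = f 0`, `c₂ = f' 0`. -/
theorem stmt6 (f : ℝ → ℝ) (hf : Differentiable ℝ f)
    (hf' : Differentiable ℝ (deriv f))
    (heq : ∀ x : ℝ, -(deriv (deriv f)) x + (9 * x ^ 4 - 6 * x) * f x = 0) :
    ∀ x : ℝ, f x = f 0 * Real.exp (-x ^ 3)
      + deriv f 0 * (Real.exp (-x ^ 3) * ∫ u in (0:ℝ)..x, Real.exp (2 * u ^ 3)) := by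
  have d1 : ∀ x, HasDerivAt f (deriv f x) x := fun x => (hf x).hasDerivAt
  have d2 : ∀ x, HasDerivAt (deriv f) ((9 * x ^ 4 - 6 * x) * f x) x := fun x => by
    have h := (hf' x).hasDerivAt
    rwa [show deriv (deriv f) x = (9 * x ^ 4 - 6 * x) * f x by linarith [heq x]] at h
  have d3 : ∀ x : ℝ, HasDerivAt (fun y : ℝ => y ^ 3) (3 * x ^ 2) x := fun x => by
    simpa using hasDerivAt_pow 3 x
  have d4 : ∀ x : ℝ, HasDerivAt (fun y : ℝ => 3 * y ^ 2) (6 * x) x := fun x => by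
    have h := (hasDerivAt_pow 2 x).const_mul (3 : ℝ)
    refine h.congr_deriv ?_
    norm_num
    ring
  have g1 : ∀ x, HasDerivAt (fun y => (deriv f y + 3 * y ^ 2 * f y) * Real.exp (-y ^ 3)) 0 x := by
    intro x
    have h := ((d2 x).fun_add ((d4 x).fun_mul (d1 x))).fun_mul (d3 x).fun_neg.exp
    refine h.congr_deriv ?_
    ring
  have c1 : ∀ x, (deriv f x + 3 * x ^ 2 * f x) * Real.exp (-x ^ 3) = deriv f 0 := by
    intro x
    have h := is_const_of_deriv_eq_zero (fun y => (g1 y).differentiableAt)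
      (fun y => (g1 y).deriv) x 0
    simpa using h
  have hc : Continuous (fun u : ℝ => Real.exp (2 * u ^ 3)) := by fun_prop
  have g2 : ∀ x, HasDerivAt (fun y => f y * Real.exp (y ^ 3)
      - deriv f 0 * ∫ u in (0:ℝ)..y, Real.exp (2 * u ^ 3)) 0 x := by
    intro x
    have h := ((d1 x).fun_mul (d3 x).exp).fun_sub
      ((hc.integral_hasStrictDerivAt 0 x).hasDerivAt.const_mul (deriv f 0))
    refine h.congr_deriv ?_
    rw [← c1 x, show 2 * x ^ 3 = x ^ 3 + x ^ 3 by ring, Real.exp_add, Real.exp_neg]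
    have := Real.exp_ne_zero (x ^ 3)
    field_simp
    ring
  intro x
  have h := is_const_of_deriv_eq_zero (fun y => (g2 y).differentiableAt)
      (fun y => (g2 y).deriv) x 0
  simp only [intervalIntegral.integral_same] at h
  norm_num at h
  rw [← h, Real.exp_neg]
  have := Real.exp_ne_zero (x ^ 3)
  field_simp
  ring
end
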